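/- Let G be a connected split graph with vertex partition into a clique K and an independent set I, let c ≥ 2, and let S, T be c-colorable sets with |S| = |T|, |S ∩ K| = c and |T ∩ K| ≤ c−1. Then T is c-reachable from S under TS if and only if there exist c-colorable sets A and B such that A ∩ I = S ∩ I, |A ∩ K| = c, S has a rigid c-transformation to A, and B is obtained from A by one TS move with |B ∩ K| = c−1. -/

import Mathlib

open SimpleGraph

/-- A single token-sliding (TS) move from `S` to `T`. -/
def TSMove {V : Type*} (G : SimpleGraph V) (S T : Set V) : Prop :=
  S.ncard = T.ncard ∧ ∃ u v : V, G.Adj u v ∧ T \ S = {u} ∧ S \ T = {v}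

/-- `S` is `c`-colorable: the subgraph induced by `S` admits a proper `c`-coloring. -/
def CColorable {V : Type*} (G : SimpleGraph V) (c : ℕ) (S : Set V) : Prop :=
  (G.induce S).Colorable c

/-- One TS step between `c`-colorable sets. -/
def TSStep {V : Type*} (G : SimpleGraph V) (c : ℕ) (S T : Set V) : Prop :=
  CColorable G c S ∧ CColorable G c T ∧ TSMove G S T

/-- `T` is `c`-reachable from `S` under token sliding. -/
def TSReachable {V : Type*} (G : SimpleGraph V) (c : ℕ) : Set V → Set V → Prop :=
  Relation.ReflTransGen (TSStep G c)

/-- A rigid TS step with respect to the independent side `A`: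
a TS step that does not change the trace on `A`. -/
def RigidStep {V : Type*} (G : SimpleGraph V) (c : ℕ) (A : Set V) (S T : Set V) : Prop :=
  TSStep G c S T ∧ S ∩ A = T ∩ A

/-- `S` has a rigid `c`-transformation to `T`: a TS transformation through
`c`-colorable sets every one of which has the same trace on `A` as `S`. -/
def RigidReachable {V : Type*} (G : SimpleGraph V) (c : ℕ) (A : Set V) :
    Set V → Set V → Prop :=
  Relation.ReflTransGen (RigidStep G c A)

/-- `S` is an independent set of `G`. -/
def IsIndep {V : Type*} (G : SimpleGraph V) (S : Set V) : Prop :=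
  S.Pairwise fun u v => ¬ G.Adj u v

section SplitGraph

variable {V : Type*} {G : SimpleGraph V} {K S T : Set V} {c : ℕ}

theorem TSMove.symm (h : TSMove G S T) : TSMove G T S := by
  obtain ⟨h, u, v, huv, hu, hv⟩ := h
  exact ⟨h.symm, v, u, huv.symm, hv, hu⟩

theorem TSReachable.symm (h : TSReachable G c S T) : TSReachable G c T S :=
  have : Std.Symm (TSStep G c) := ⟨fun _ _ h => ⟨h.2.1, h.1, h.2.2.symm⟩⟩
  Relation.ReflTransGen.stdSymm.symm _ _ h

theorem CColorable.ncard_inter_le [Finite V] (hK : G.IsClique K) (h : CColorable G c S) :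
    (S ∩ K).ncard ≤ c := by
  obtain ⟨f⟩ := h
  let g : ↥(S ∩ K) → Fin c := fun x => f ⟨x, x.2.1⟩
  have hg : Function.Injective g := by
    intro x y hxy
    by_contra hne
    exact f.valid (v := ⟨x, x.2.1⟩) (w := ⟨y, y.2.1⟩)
      (hK x.2.2 y.2.2 fun h => hne (Subtype.ext h)) hxy
  simpa [Nat.card_coe_set_eq] using Nat.card_le_card_of_injective g hg

theorem cColorable_of_ncard_inter_lt [Finite V] (hI : IsIndep G Kᶜ) (h : (S ∩ K).ncard < c) :
    CColorable G c S := by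
  classical
  have := Fintype.ofFinite V
  let f : (G.induce S).Coloring (Option ↥(S ∩ K)) :=
    Coloring.mk (fun x => if hx : (x : V) ∈ K then some ⟨x, x.2, hx⟩ else none) (by
      intro x y hxy
      have hadj : G.Adj x y := hxy
      by_cases hx : (x : V) ∈ K <;> by_cases hy : (y : V) ∈ K
      · simpa [hx, hy, Subtype.ext_iff] using hadj.ne
      · simp [hx, hy]
      · simp [hx, hy]
      · exact absurd hadj (hI hx hy hadj.ne))
  refine f.colorable.mono ?_
  rw [Fintype.card_option, ← Nat.card_eq_fintype_card, Nat.card_coe_set_eq]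
  exact h

theorem tsMove_insert_diff [Finite V] {u v : V} (hv : v ∈ S) (hu : u ∉ S) (huv : G.Adj u v) :
    TSMove G S (insert u (S \ {v})) := by
  refine ⟨(Set.ncard_exchange hu hv).symm, u, v, huv, ?_, ?_⟩ <;> ext x <;> grind

theorem TSMove.exists_eq_insert (h : TSMove G S T) :
    ∃ u v, G.Adj u v ∧ v ∈ S ∧ u ∉ S ∧ T = insert u (S \ {v}) := by
  obtain ⟨-, u, v, huv, hu, hv⟩ := h
  have hu' : ∀ x, x ∈ T ∧ x ∉ S ↔ x = u := Set.ext_iff.1 hu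
  have hv' : ∀ x, x ∈ S ∧ x ∉ T ↔ x = v := Set.ext_iff.1 hv
  refine ⟨u, v, huv, ?_, ?_, ?_⟩
  · grind
  · grind
  · ext x; grind

theorem ncard_insert_diff_inter_of_mem [Finite V] {u v : V} (hv : v ∈ S) (hu : u ∉ S)
    (hvK : v ∈ K) (huK : u ∈ K) : (insert u (S \ {v}) ∩ K).ncard = (S ∩ K).ncard := by
  rw [← Set.ncard_exchange (s := S ∩ K) (a := u) (b := v) (by grind) ⟨hv, hvK⟩]
  congr 1; ext x; grind

theorem ncard_insert_diff_inter_add_one [Finite V] {u v : V} (hv : v ∈ S)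
    (hvK : v ∈ K) (huK : u ∉ K) :
    (insert u (S \ {v}) ∩ K).ncard + 1 = (S ∩ K).ncard := by
  rw [← Set.ncard_sdiff_singleton_add_one (s := S ∩ K) (a := v) ⟨hv, hvK⟩]
  congr 2; ext x; grind

theorem ncard_insert_diff_inter_eq_add_one [Finite V] {u v : V} (hu : u ∉ S)
    (hvK : v ∉ K) (huK : u ∈ K) :
    (insert u (S \ {v}) ∩ K).ncard = (S ∩ K).ncard + 1 := by
  rw [← Set.ncard_insert_of_notMem (s := S ∩ K) (a := u) (by grind)]
  congr 1; ext x; grind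

theorem tsReachable_insert_diff [Finite V] (hI : IsIndep G Kᶜ) {u v : V} (hv : v ∈ S)
    (hu : u ∉ S) (huv : G.Adj u v) (hS : (S ∩ K).ncard < c)
    (hS' : (insert u (S \ {v}) ∩ K).ncard < c) : TSReachable G c S (insert u (S \ {v})) :=
  .single ⟨cColorable_of_ncard_inter_lt hI hS, cColorable_of_ncard_inter_lt hI hS',
    tsMove_insert_diff hv hu huv⟩

/-- If the clique carries a token, some clique token can be brought to any free vertex of the
independent side. -/
theorem exists_tsReachable_insert_diff [Finite V] (hK : G.IsClique K) (hI : IsIndep G Kᶜ)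
    (hnbr : ∀ i ∉ K, ∃ x ∈ K, G.Adj i x) {i y : V} (hi : i ∉ K) (hiS : i ∉ S)
    (hyS : y ∈ S) (hyK : y ∈ K) (hS : (S ∩ K).ncard < c) :
    ∃ z ∈ K, z ∈ S ∧ TSReachable G c S (insert i (S \ {z})) := by
  obtain ⟨x, hxK, hix⟩ := hnbr i hi
  by_cases hxS : x ∈ S
  · have := ncard_insert_diff_inter_add_one hxS hxK hi
    exact ⟨x, hxK, hxS, tsReachable_insert_diff hI hxS hiS hix hS (by omega)⟩
  · refine ⟨y, hyK, hyS, ?_⟩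
    have h1 := ncard_insert_diff_inter_of_mem hyS hxS hyK hxK
    have hxy : x ≠ y := by grind
    have h2 := tsReachable_insert_diff hI hyS hxS (hK hxK hyK hxy) hS (h1 ▸ hS)
    have hx' : x ∈ insert x (S \ {y}) := Set.mem_insert _ _
    have h3 := ncard_insert_diff_inter_add_one hx' hxK hi
    have h4 := tsReachable_insert_diff (c := c) hI hx' (by grind) hix (by omega) (by omega)
    have h5 : insert i (insert x (S \ {y}) \ {x}) = insert i (S \ {y}) := by ext z; grind
    exact h2.trans (h5 ▸ h4)

theorem tsReachable_of_diff_eq [Finite V] (hK : G.IsClique K) (hI : IsIndep G Kᶜ)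
    (hS : (S ∩ K).ncard < c) (hcard : S.ncard = T.ncard) (hST : S \ K = T \ K) :
    TSReachable G c S T := by
  induction hn : (T \ S).ncard generalizing S with
  | zero =>
    have hsub : T ⊆ S := by
      rw [Set.ncard_eq_zero] at hn
      exact Set.sdiff_eq_empty.1 hn
    rw [Set.eq_of_subset_of_ncard_le hsub hcard.le]
    exact .refl
  | succ n ih =>
    have hST' : ∀ x, x ∈ S ∧ x ∉ K ↔ x ∈ T ∧ x ∉ K := Set.ext_iff.1 hST
    obtain ⟨u, huT, huS⟩ := (Set.ncard_pos (s := T \ S)).1 (by omega)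
    obtain ⟨v, hvS, hvT⟩ : (S \ T).Nonempty := by
      rw [Set.sdiff_nonempty]
      intro hsub
      rw [Set.eq_of_subset_of_ncard_le hsub hcard.ge] at huS
      exact huS huT
    have huK : u ∈ K := by grind
    have hvK : v ∈ K := by grind
    have h1 := ncard_insert_diff_inter_of_mem hvS huS hvK huK
    refine (tsReachable_insert_diff hI hvS huS (hK huK hvK (by grind)) hS (by omega)).trans
      (ih (by omega) (by rw [Set.ncard_exchange huS hvS, hcard]) (by ext x; grind) ?_)
    have h2 : T \ insert u (S \ {v}) = (T \ S) \ {u} := by ext x; grind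
    have huTS : u ∈ T \ S := ⟨huT, huS⟩
    rw [h2, Set.ncard_sdiff_singleton_of_mem huTS, hn, Nat.add_sub_cancel]

theorem TSReachable.ncard_eq (h : TSReachable G c S T) : S.ncard = T.ncard := by
  induction h with
  | refl => rfl
  | tail _ h ih => exact ih.trans h.2.2.1

theorem exists_tsReachable_symmDiff_ssubset [Finite V] (hK : G.IsClique K) (hI : IsIndep G Kᶜ)
    (hnbr : ∀ i ∉ K, ∃ x ∈ K, G.Adj i x) (hc : 2 ≤ c) (hS : (S ∩ K).ncard < c)
    (hcard : S.ncard = T.ncard) {i : V} (hi : i ∉ K) (hiT : i ∈ T) (hiS : i ∉ S) :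
    ∃ S', TSReachable G c S S' ∧ (S' ∩ K).ncard < c ∧
      symmDiff (S' \ K) (T \ K) ⊂ symmDiff (S \ K) (T \ K) := by
  by_cases hne : (S ∩ K).Nonempty
  · obtain ⟨y, hyS, hyK⟩ := hne
    obtain ⟨z, hzK, hzS, hz⟩ := exists_tsReachable_insert_diff hK hI hnbr hi hiS hyS hyK hS
    have := ncard_insert_diff_inter_add_one hzS hzK hi
    refine ⟨_, hz, by omega, ?_⟩
    rw [Set.ssubset_iff_of_subset (by intro x; simp only [Set.mem_symmDiff]; grind)]
    exact ⟨i, by simp only [Set.mem_symmDiff]; grind, by simp only [Set.mem_symmDiff]; grind⟩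
  · obtain ⟨j, hjS, hjT⟩ : (S \ T).Nonempty := by
      rw [Set.sdiff_nonempty]
      intro hsub
      rw [Set.eq_of_subset_of_ncard_le hsub hcard.ge] at hiS
      exact hiS hiT
    rw [Set.not_nonempty_iff_eq_empty] at hne
    have hne' : ∀ x ∈ S, x ∉ K := fun x hx hxK => hne.subset ⟨hx, hxK⟩
    have hjK : j ∉ K := by grind
    obtain ⟨x, hxK, hjx⟩ := hnbr j hjK
    have hxS : x ∉ S := by grind
    have h1 := ncard_insert_diff_inter_eq_add_one hxS hjK hxK
    rw [hne, Set.ncard_empty] at h1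
    refine ⟨_, tsReachable_insert_diff hI hjS hxS hjx.symm hS (by omega), by omega, ?_⟩
    rw [Set.ssubset_iff_of_subset (by intro x; simp only [Set.mem_symmDiff]; grind)]
    exact ⟨j, by simp only [Set.mem_symmDiff]; grind, by simp only [Set.mem_symmDiff]; grind⟩

/-- Sets of equal size with fewer than `c` clique tokens are mutually reachable. -/
theorem tsReachable_of_ncard_inter_lt [Finite V] (hK : G.IsClique K) (hI : IsIndep G Kᶜ)
    (hnbr : ∀ i ∉ K, ∃ x ∈ K, G.Adj i x) (hc : 2 ≤ c) (hS : (S ∩ K).ncard < c)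
    (hT : (T ∩ K).ncard < c) (hcard : S.ncard = T.ncard) : TSReachable G c S T := by
  induction hn : (symmDiff (S \ K) (T \ K)).ncard using Nat.strong_induction_on
    generalizing S T with
  | _ n ih =>
    subst hn
    by_cases h1 : ∃ i ∉ K, i ∈ T ∧ i ∉ S
    · obtain ⟨i, hi, hiT, hiS⟩ := h1
      obtain ⟨S', hr, hS', hlt⟩ :=
        exists_tsReachable_symmDiff_ssubset hK hI hnbr hc hS hcard hi hiT hiS
      exact hr.trans (ih _ (Set.ncard_lt_ncard hlt) hS' hT (hr.ncard_eq.symm.trans hcard) rfl)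
    by_cases h2 : ∃ i ∉ K, i ∈ S ∧ i ∉ T
    · obtain ⟨i, hi, hiS, hiT⟩ := h2
      obtain ⟨T', hr, hT', hlt⟩ :=
        exists_tsReachable_symmDiff_ssubset hK hI hnbr hc hT hcard.symm hi hiS hiT
      rw [symmDiff_comm, symmDiff_comm (T \ K)] at hlt
      exact (ih _ (Set.ncard_lt_ncard hlt) hS hT' (hcard.trans hr.ncard_eq) rfl).trans hr.symm
    · push Not at h1 h2
      exact tsReachable_of_diff_eq hK hI hS hcard (by ext x; grind)

theorem exists_rigidReachable_of_tsReachable [Finite V] (hK : G.IsClique K)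
    (hI : IsIndep G Kᶜ) (hSK : (S ∩ K).ncard = c) (h : TSReachable G c S T) :
    (RigidReachable G c Kᶜ S T ∧ T ∩ Kᶜ = S ∩ Kᶜ ∧ (T ∩ K).ncard = c) ∨
      ∃ A B : Set V, CColorable G c A ∧ CColorable G c B ∧
        A ∩ Kᶜ = S ∩ Kᶜ ∧ (A ∩ K).ncard = c ∧
        RigidReachable G c Kᶜ S A ∧ TSStep G c A B ∧ (B ∩ K).ncard = c - 1 := by
  induction h with
  | refl => exact .inl ⟨.refl, rfl, hSK⟩
  | @tail X Y _ hXY ih =>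
    refine ih.elim (fun ⟨hr, hXI, hXK⟩ => ?_) .inr
    have hle := hXY.2.1.ncard_inter_le hK
    obtain ⟨u, v, huv, hv, hu, rfl⟩ := hXY.2.2.exists_eq_insert
    by_cases huK : u ∈ K <;> by_cases hvK : v ∈ K
    · have hI' : insert u (X \ {v}) ∩ Kᶜ = X ∩ Kᶜ := by ext x; grind
      exact .inl ⟨hr.tail ⟨hXY, hI'.symm⟩, hI'.trans hXI,
        (ncard_insert_diff_inter_of_mem hv hu hvK huK).trans hXK⟩
    · have := ncard_insert_diff_inter_eq_add_one hu hvK huK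
      omega
    · have := ncard_insert_diff_inter_add_one hv hvK huK
      exact .inr ⟨X, _, hXY.1, hXY.2.1, hXI, hXK, hr, hXY, by omega⟩
    · exact absurd huv (hI huK hvK huv.ne)

end SplitGraph

/-- On a connected split graph (clique `K`, independent set `I`), for `c ≥ 2` and
`c`-colorable sets `S`, `T` of the same size with `|S ∩ K| = c` and `|T ∩ K| ≤ c - 1`:
`T` is `c`-reachable from `S` iff there are `c`-colorable sets `A`, `B` with
`A ∩ I = S ∩ I`, `|A ∩ K| = c`, a rigid `c`-transformation from `S` to `A`, and
`B` obtained from `A` by one TS move with `|B ∩ K| = c - 1`. -/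
theorem stmt4 {V : Type*} [Fintype V] (G : SimpleGraph V) (K I : Set V)
    (hpart : K ∪ I = Set.univ) (hdisj : Disjoint K I)
    (hK : G.IsClique K) (hI : IsIndep G I) (hconn : G.Connected)
    (c : ℕ) (hc : 2 ≤ c) (S T : Set V)
    (hS : CColorable G c S) (hT : CColorable G c T) (hST : S.ncard = T.ncard)
    (hSK : (S ∩ K).ncard = c) (hTK : (T ∩ K).ncard ≤ c - 1) :
    TSReachable G c S T ↔
      ∃ A B : Set V, CColorable G c A ∧ CColorable G c B ∧
        A ∩ I = S ∩ I ∧ (A ∩ K).ncard = c ∧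
        RigidReachable G c I S A ∧ TSStep G c A B ∧ (B ∩ K).ncard = c - 1 := by
  obtain rfl : I = Kᶜ :=
    (IsCompl.compl_eq ⟨hdisj, codisjoint_iff.2 hpart⟩).symm
  constructor
  · intro h
    refine (exists_rigidReachable_of_tsReachable hK hI hSK h).resolve_left fun h => ?_
    have := h.2.2
    omega
  · rintro ⟨A, B, -, -, -, -, hr, hAB, hBK⟩
    have hle : RigidStep G c Kᶜ ≤ TSStep G c := fun _ _ h => h.1
    have hSB : TSReachable G c S B :=
      Relation.ReflTransGen.tail (Relation.ReflTransGen.mono hle _ _ hr) hAB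
    have hnbr : ∀ i ∉ K, ∃ x ∈ K, G.Adj i x := by
      intro i hi
      obtain ⟨k, hk⟩ := (Set.ncard_pos (s := S ∩ K)).1 (by omega)
      have : Nontrivial V := ⟨i, k, fun h => hi (h ▸ hk.2)⟩
      obtain ⟨x, hx⟩ := hconn.preconnected.exists_adj_of_nontrivial i
      exact ⟨x, by_contra fun hxK => hI hi hxK hx.ne hx, hx⟩
    exact hSB.trans (tsReachable_of_ncard_inter_lt hK hI hnbr hc (by omega) (by omega)
      (hSB.ncard_eq.symm.trans hST))
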